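/- arXiv:1810.01337 — 6 statements merged into one kernel-verified Lean document; each statement's English description precedes it below -/
import Mathlib

section
/- For every integer l ≥ 2 with λ := (l−1)(l+2) and every real μ ∈ [0,1], one has (2−3μ)² + (2+9μ)(λ+2) ≤ 2(λ+3μ)². (This is the spherical-harmonic-mode form of the refined estimate (4/r²)(r−3M)²‖Z⁻¹f‖² + (2/r)(r+9M)‖(r∇̸)Z⁻¹f‖² ≲ ‖f‖², where Z⁻¹ denotes the inverse of r²Δ̸+2−3μ and μ = 2M/r; in particular it yields (λ+2)(2+9μ) ≤ 2(λ+3μ)², i.e. ‖(r∇̸)Z⁻¹f‖² ≤ (2/(2+9μ))‖f‖² on each mode.) -/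
/-- For every integer `l ≥ 2` with `λ := (l−1)(l+2)` and every real
`μ ∈ [0,1]`, one has `(2−3μ)² + (2+9μ)(λ+2) ≤ 2(λ+3μ)²`.
This is the spherical-harmonic-mode form of the refined estimate
`(4/r²)(r−3M)²‖Z⁻¹f‖² + (2/r)(r+9M)‖(r∇̸)Z⁻¹f‖² ≲ ‖f‖²`, where `Z⁻¹` denotes the
inverse of `r²Δ̸+2−3μ` and `μ = 2M/r`. -/
theorem mode_refined_estimate_inverse_zerilli_operator
    (l : ℤ) (hl : 2 ≤ l) (μ : ℝ) (hμ0 : 0 ≤ μ) (hμ1 : μ ≤ 1) :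
    (2 - 3 * μ) ^ 2 + (2 + 9 * μ) * (((l : ℝ) - 1) * ((l : ℝ) + 2) + 2)
      ≤ 2 * (((l : ℝ) - 1) * ((l : ℝ) + 2) + 3 * μ) ^ 2 := by
  have hl' : (2 : ℝ) ≤ l := by exact_mod_cast hl
  have hL : 4 ≤ ((l : ℝ) - 1) * ((l : ℝ) + 2) := by nlinarith
  generalize ((l : ℝ) - 1) * ((l : ℝ) + 2) = L at hL ⊢
  nlinarith [mul_nonneg (sub_nonneg.2 hL) hμ0, mul_self_nonneg (L - 4), mul_self_nonneg μ]
end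

section
/- Define, for an integer l ≥ 2 with λ := (l−1)(l+2) and real μ ∈ [0,1], N(λ,μ) := (λ+2) − 3μ − 6μ(2−3μ)(λ+2)/(λ+3μ)² + 6μ((2−3μ)² + 3μ(1−μ))/(λ+3μ)². Then (λ+2)/4 ≤ N(λ,μ) ≤ 2(λ+2) for all such l and μ. (N(λ,μ) is the coefficient, on the spherical-harmonic mode of degree l, of the modified angular energy density ‖∇̸_Z Ψ‖² appearing in the energy estimate for the Zerilli equation, so this states that the modified angular energy is comparable to the true angular energy ‖∇̸Ψ‖², whose mode coefficient is λ+2.) -/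
/-- The coefficient, on the spherical-harmonic mode of degree `l` (with
`λ = (l−1)(l+2)`), of the modified angular energy density `‖∇̸_Z Ψ‖²` appearing in
the energy estimate for the Zerilli equation. -/
noncomputable def modifiedAngularCoeff (lam μ : ℝ) : ℝ :=
  (lam + 2) - 3 * μ - 6 * μ * (2 - 3 * μ) * (lam + 2) / (lam + 3 * μ) ^ 2
    + 6 * μ * ((2 - 3 * μ) ^ 2 + 3 * μ * (1 - μ)) / (lam + 3 * μ) ^ 2

/-- For every integer `l ≥ 2` with `λ := (l−1)(l+2)` and every real
`μ ∈ [0,1]`, the modified angular energy coefficient `N(λ,μ)` satisfies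
`(λ+2)/4 ≤ N(λ,μ) ≤ 2(λ+2)`: the modified angular energy is comparable to the true
angular energy `‖∇̸Ψ‖²`, whose mode coefficient is `λ+2`. -/
theorem modified_angular_energy_comparable
    (l : ℤ) (hl : 2 ≤ l) (lam : ℝ) (hlam : lam = ((l : ℝ) - 1) * ((l : ℝ) + 2))
    (μ : ℝ) (hμ0 : 0 ≤ μ) (hμ1 : μ ≤ 1) :
    (lam + 2) / 4 ≤ modifiedAngularCoeff lam μ ∧
      modifiedAngularCoeff lam μ ≤ 2 * (lam + 2) := by
  have hl' : (2 : ℝ) ≤ l := by exact_mod_cast hl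
  have hlam4 : 4 ≤ lam := by rw [hlam]; nlinarith
  have hD16 : 16 ≤ (lam + 3 * μ) ^ 2 := by nlinarith
  have hN : modifiedAngularCoeff lam μ = (lam + 2) - 3 * μ
      + 6 * (μ * ((2 - 3 * μ) ^ 2 + 3 * μ * (1 - μ)) - μ * (2 - 3 * μ) * (lam + 2))
        / (lam + 3 * μ) ^ 2 := by
    unfold modifiedAngularCoeff
    ring
  rw [hN]
  generalize (lam + 3 * μ) ^ 2 = D at hD16
  have hD : 0 < D := by linarith
  have h_cross_upper : μ * (2 - 3 * μ) ≤ 1 / 3 := by nlinarith [sq_nonneg (3 * μ - 1)]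
  have h_cross_lower : -1 ≤ μ * (2 - 3 * μ) := by nlinarith
  have h_last_nonneg : 0 ≤ μ * ((2 - 3 * μ) ^ 2 + 3 * μ * (1 - μ)) := by
    have := sub_nonneg.2 hμ1
    positivity
  have h_last_le : μ * ((2 - 3 * μ) ^ 2 + 3 * μ * (1 - μ)) ≤ 4 := by
    have : (2 - 3 * μ) ^ 2 + 3 * μ * (1 - μ) ≤ 4 := by nlinarith
    nlinarith
  constructor
  · have : -(3 / 4 * (lam - 2)) ≤
        6 * (μ * ((2 - 3 * μ) ^ 2 + 3 * μ * (1 - μ)) - μ * (2 - 3 * μ) * (lam + 2)) / D := by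
      rw [le_div_iff₀ hD]
      nlinarith
    linarith
  · have : 6 * (μ * ((2 - 3 * μ) ^ 2 + 3 * μ * (1 - μ)) - μ * (2 - 3 * μ) * (lam + 2)) / D
        ≤ lam + 2 := by
      rw [div_le_iff₀ hD]
      nlinarith
    linarith
end

section
/- For every integer l ≥ 2 with λ := (l−1)(l+2) and every real μ ∈ [0,1], one has (λ+2)/4 ≤ (λ+2) − 4μ − 6μ(2−3μ)/(λ+3μ) + 18μ²(1−μ)/(λ+3μ)² ≤ 2(λ+2). (The middle quantity equals l(l+1) + r²W_λ(r) with μ = 2M/r, where W_λ(r) := −8M/r³ − 24M(r−3M)/(r⁴(λ+3μ)) + 72M²(r−2M)/(r⁵(λ+3μ)²) is the potential of the Zerilli equation on the mode of degree l; hence the potential part of the Zerilli energy density is everywhere comparable to l(l+1) on the Schwarzschild exterior.) -/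
/-- For every integer `l ≥ 2` with `λ := (l−1)(l+2)` and every real
`μ ∈ [0,1]`, one has
`(λ+2)/4 ≤ (λ+2) − 4μ − 6μ(2−3μ)/(λ+3μ) + 18μ²(1−μ)/(λ+3μ)² ≤ 2(λ+2)`.
The middle quantity equals `l(l+1) + r²W_λ(r)` with `μ = 2M/r`, where `W_λ` is the
potential of the Zerilli equation on the mode of degree `l`; hence the potential part
of the Zerilli energy density is everywhere comparable to `l(l+1)` on the
Schwarzschild exterior. -/
theorem zerilli_potential_comparable
    (l : ℤ) (hl : 2 ≤ l) (lam : ℝ) (hlam : lam = ((l : ℝ) - 1) * ((l : ℝ) + 2))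
    (μ : ℝ) (hμ0 : 0 ≤ μ) (hμ1 : μ ≤ 1) :
    (lam + 2) / 4 ≤
        (lam + 2) - 4 * μ - 6 * μ * (2 - 3 * μ) / (lam + 3 * μ)
          + 18 * μ ^ 2 * (1 - μ) / (lam + 3 * μ) ^ 2 ∧
      (lam + 2) - 4 * μ - 6 * μ * (2 - 3 * μ) / (lam + 3 * μ)
          + 18 * μ ^ 2 * (1 - μ) / (lam + 3 * μ) ^ 2 ≤ 2 * (lam + 2) := by
  have hl2 : (2 : ℝ) ≤ l := by exact_mod_cast hl
  have hlam4 : 4 ≤ lam := by nlinarith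
  have hD : 4 ≤ lam + 3 * μ := by linarith
  have hDpos : 0 < lam + 3 * μ := by linarith
  have hμ2 : μ ^ 2 ≤ 1 := pow_le_one₀ hμ0 hμ1
  constructor
  · have hlast : 0 ≤ 18 * μ ^ 2 * (1 - μ) / (lam + 3 * μ) ^ 2 :=
      div_nonneg (mul_nonneg (by positivity) (by linarith)) (by positivity)
    have hmid : 6 * μ * (2 - 3 * μ) / (lam + 3 * μ) ≤ 3 * (lam + 2) / 4 - 4 * μ := by
      rw [div_le_iff₀ hDpos]
      have hmono : (9 / 2 - 4 * μ) * (4 + 3 * μ) ≤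
          (3 * (lam + 2) / 4 - 4 * μ) * (lam + 3 * μ) :=
        mul_le_mul (by linarith) (by linarith) (by linarith) (by linarith)
      nlinarith [sq_nonneg (μ - 1)]
    linarith
  · have hmid : -(9 / 2) ≤ 6 * μ * (2 - 3 * μ) / (lam + 3 * μ) := by
      rw [le_div_iff₀ hDpos]
      nlinarith
    have hlast : 18 * μ ^ 2 * (1 - μ) / (lam + 3 * μ) ^ 2 ≤ 9 / 8 := by
      rw [div_le_iff₀ (by positivity)]
      have hnum : μ ^ 2 * (1 - μ) ≤ 1 :=
        mul_le_one₀ hμ2 (by linarith) (by linarith)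
      nlinarith
    linarith
end

section
/- Let ψ : ℝ × ℝ → ℝ be twice continuously differentiable on U := ℝ × (2M,∞) and satisfy the mode-l Zerilli equation ∂_t( r²(−(1+μ)∂_tψ + μ∂_rψ) ) + ∂_r( r²(μ∂_tψ + (1−μ)∂_rψ) ) − l(l+1)ψ − r²W_λ(r)ψ = 0 at every point of U. Then the energy identity ∂_t E(t,r) = ∂_r F(t,r) holds at every point of U, where E(t,r) = ½r²(1+μ)(∂_tψ)² + ½r²(1−μ)(∂_rψ)² + ½(l(l+1)+r²W_λ(r))ψ² and F(t,r) = r²∂_tψ(μ∂_tψ + (1−μ)∂_rψ). -/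
noncomputable section

open Set

/-- The partial derivative `∂_t` of a function of `(t,r) ∈ ℝ × ℝ`. -/
def pt (f : ℝ × ℝ → ℝ) (p : ℝ × ℝ) : ℝ := fderiv ℝ f p ((1 : ℝ), (0 : ℝ))

/-- The partial derivative `∂_r` of a function of `(t,r) ∈ ℝ × ℝ`. -/
def pr (f : ℝ × ℝ → ℝ) (p : ℝ × ℝ) : ℝ := fderiv ℝ f p ((0 : ℝ), (1 : ℝ))

/-- `μ = 2M/r` on the Schwarzschild exterior. -/
def mu (M r : ℝ) : ℝ := 2 * M / r

/-- The Zerilli potential `W_λ(r)` on the spherical-harmonic mode with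
`λ = (l−1)(l+2)`. -/
def Wz (M lam r : ℝ) : ℝ :=
  -8 * M / r ^ 3 - 24 * M * (r - 3 * M) / (r ^ 4 * (lam + 3 * mu M r))
    + 72 * M ^ 2 * (r - 2 * M) / (r ^ 5 * (lam + 3 * mu M r) ^ 2)

/-- The mode-`l` Zerilli equation in Schwarzschild-star coordinates on
`U = ℝ × (2M,∞)`:
`∂_t( r²(−(1+μ)∂_tψ + μ∂_rψ) ) + ∂_r( r²(μ∂_tψ + (1−μ)∂_rψ) ) − l(l+1)ψ − r²W_λ ψ = 0`. -/
def ZerilliEq (M lam : ℝ) (l : ℤ) (ψ : ℝ × ℝ → ℝ) : Prop :=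
  ∀ p : ℝ × ℝ, 2 * M < p.2 →
    pt (fun q : ℝ × ℝ =>
        q.2 ^ 2 * (-(1 + mu M q.2) * pt ψ q + mu M q.2 * pr ψ q)) p
    + pr (fun q : ℝ × ℝ =>
        q.2 ^ 2 * (mu M q.2 * pt ψ q + (1 - mu M q.2) * pr ψ q)) p
    - (l : ℝ) * ((l : ℝ) + 1) * ψ p - p.2 ^ 2 * Wz M lam p.2 * ψ p = 0

/-- The Zerilli energy density
`E = ½r²(1+μ)(∂_tψ)² + ½r²(1−μ)(∂_rψ)² + ½(l(l+1)+r²W_λ)ψ²`. -/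
def Ez (M lam : ℝ) (l : ℤ) (ψ : ℝ × ℝ → ℝ) (p : ℝ × ℝ) : ℝ :=
  (1 / 2) * p.2 ^ 2 * (1 + mu M p.2) * (pt ψ p) ^ 2
  + (1 / 2) * p.2 ^ 2 * (1 - mu M p.2) * (pr ψ p) ^ 2
  + (1 / 2) * ((l : ℝ) * ((l : ℝ) + 1) + p.2 ^ 2 * Wz M lam p.2) * ψ p ^ 2

/-- The Zerilli energy flux `F = r²∂_tψ(μ∂_tψ + (1−μ)∂_rψ)`. -/
def Fz (M : ℝ) (ψ : ℝ × ℝ → ℝ) (p : ℝ × ℝ) : ℝ :=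
  p.2 ^ 2 * pt ψ p * (mu M p.2 * pt ψ p + (1 - mu M p.2) * pr ψ p)

/-- Both first partial derivatives of a `C²` function are differentiable, and its mixed second
partial derivatives agree. -/
theorem ContDiffAt.partials_differentiableAt_and_comm {ψ : ℝ × ℝ → ℝ} {p : ℝ × ℝ}
    (h : ContDiffAt ℝ 2 ψ p) :
    DifferentiableAt ℝ (pt ψ) p ∧ DifferentiableAt ℝ (pr ψ) p ∧ pr (pt ψ) p = pt (pr ψ) p := by
  have hd : DifferentiableAt ℝ (fderiv ℝ ψ) p :=
    (h.fderiv_right (m := 1) (by norm_num)).differentiableAt (by norm_num)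
  have happ (v : ℝ × ℝ) : HasFDerivAt (fun q => fderiv ℝ ψ q v)
      ((fderiv ℝ (fderiv ℝ ψ) p).flip v) p := by
    simpa using hd.hasFDerivAt.clm_apply (hasFDerivAt_const v p)
  have ht : HasFDerivAt (pt ψ) _ p := happ (1, 0)
  have hr : HasFDerivAt (pr ψ) _ p := happ (0, 1)
  refine ⟨ht.differentiableAt, hr.differentiableAt, ?_⟩
  have hsymm : IsSymmSndFDerivAt ℝ ψ p := h.isSymmSndFDerivAt (by simp)
  rw [pr, ht.fderiv, pt, hr.fderiv]
  exact hsymm _ _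

/-- The energy identity for a wave equation on `ℝ × ℝ` whose coefficients `a`, `b`, `c`, `V`
depend only on the second variable. -/
theorem pt_energy_eq_pr_flux {a b c V : ℝ → ℝ} {ψ : ℝ × ℝ → ℝ} {p : ℝ × ℝ}
    (ha : DifferentiableAt ℝ a p.2) (hb : DifferentiableAt ℝ b p.2)
    (hc : DifferentiableAt ℝ c p.2) (hV : DifferentiableAt ℝ V p.2)
    (hψ : ContDiffAt ℝ 2 ψ p)
    (heq : pt (fun q => -a q.2 * pt ψ q + b q.2 * pr ψ q) p
      + pr (fun q => b q.2 * pt ψ q + c q.2 * pr ψ q) p - V p.2 * ψ p = 0) :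
    pt (fun q => 1 / 2 * (a q.2 * pt ψ q ^ 2 + c q.2 * pr ψ q ^ 2 + V q.2 * ψ q ^ 2)) p
      = pr (fun q => pt ψ q * (b q.2 * pt ψ q + c q.2 * pr ψ q)) p := by
  obtain ⟨ht, hr, hcomm⟩ := hψ.partials_differentiableAt_and_comm
  have hψ' := (hψ.differentiableAt (by norm_num)).hasFDerivAt
  have ht := ht.hasFDerivAt
  have hr := hr.hasFDerivAt
  have radial {f : ℝ → ℝ} (hf : DifferentiableAt ℝ f p.2) :
      HasFDerivAt (fun q : ℝ × ℝ => f q.2) (deriv f p.2 • ContinuousLinearMap.snd ℝ ℝ ℝ) p :=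
    hf.hasDerivAt.comp_hasFDerivAt p hasFDerivAt_snd
  have ha := radial ha
  have hb := radial hb
  have hc := radial hc
  have hV := radial hV
  have hG := (hb.fun_mul ht).fun_add (hc.fun_mul hr)
  have hE := ((((ha.fun_mul (ht.pow 2)).fun_add (hc.fun_mul (hr.pow 2))).fun_add
    (hV.fun_mul (hψ'.pow 2))).const_mul (1 / 2))
  have hH := (ha.fun_neg.fun_mul ht).fun_add (hb.fun_mul hr)
  have hF := ht.fun_mul hG
  have hH' := congrArg (· (1, 0)) hH.fderiv
  have hG' := congrArg (· (0, 1)) hG.fderiv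
  have hE' := congrArg (· (1, 0)) hE.fderiv
  have hF' := congrArg (· (0, 1)) hF.fderiv
  simp only [← pt.eq_1, ← pr.eq_1] at hH' hG' hE' hF'
  rw [hH', hG'] at heq
  rw [hE', hF']
  simp [← pt.eq_1, ← pr.eq_1] at heq ⊢
  rw [hcomm] at heq ⊢
  linear_combination (-pt ψ p) * heq

/-- The Zerilli potential is differentiable wherever its denominators do not vanish. -/
theorem differentiableAt_Wz {M lam r : ℝ} (hr : r ≠ 0) (hden : lam + 3 * mu M r ≠ 0) :
    DifferentiableAt ℝ (Wz M lam) r := by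
  unfold Wz mu at *
  fun_prop (disch := simp_all)

/-- If `ψ` is twice continuously differentiable on
`U = ℝ × (2M,∞)` and satisfies the mode-`l` Zerilli equation at every point of `U`,
then the energy identity `∂_t E = ∂_r F` holds at every point of `U`. -/
theorem zerilli_energy_identity
    (M : ℝ) (hM : 0 < M) (l : ℤ) (hl : 2 ≤ l)
    (lam : ℝ) (hlam : lam = ((l : ℝ) - 1) * ((l : ℝ) + 2))
    (ψ : ℝ × ℝ → ℝ)
    (hψ : ContDiffOn ℝ 2 ψ {p : ℝ × ℝ | 2 * M < p.2})
    (hZ : ZerilliEq M lam l ψ) :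
    ∀ p : ℝ × ℝ, 2 * M < p.2 →
      pt (Ez M lam l ψ) p = pr (Fz M ψ) p := by
  intro p hp
  have hr : 0 < p.2 := by linarith
  have hl' : (2 : ℝ) ≤ l := by exact_mod_cast hl
  have hden : lam + 3 * mu M p.2 ≠ 0 := by
    have hlam_pos : 0 < lam := hlam ▸ mul_pos (by linarith) (by linarith)
    have hmu_pos : 0 < mu M p.2 := div_pos (by linarith) hr
    positivity
  have hmu : DifferentiableAt ℝ (mu M) p.2 := by
    unfold mu
    fun_prop (disch := exact hr.ne')
  have hW := differentiableAt_Wz hr.ne' hden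
  have hψp : ContDiffAt ℝ 2 ψ p :=
    hψ.contDiffAt ((isOpen_lt continuous_const continuous_snd).mem_nhds hp)
  have key := pt_energy_eq_pr_flux (ψ := ψ) (p := p)
    (a := fun r => r ^ 2 * (1 + mu M r)) (b := fun r => r ^ 2 * mu M r)
    (c := fun r => r ^ 2 * (1 - mu M r)) (V := fun r => l * (l + 1) + r ^ 2 * Wz M lam r)
    (by fun_prop) (by fun_prop) (by fun_prop) (by fun_prop) hψp ?_
  · convert key using 2
    · funext q
      simp only [Ez]
      ring
    · funext q
      simp only [Fz]
      ring
  · rw [← hZ p hp, sub_sub]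
    congr 1
    · congr 2 <;> funext q <;> ring
    · ring
end
end

section
/- Let ψ : ℝ × ℝ → ℝ be twice continuously differentiable on U := ℝ × (2M,∞) and satisfy the mode-l Regge–Wheeler equation ∂_t( r²(−(1+μ)∂_tψ + μ∂_rψ) ) + ∂_r( r²(μ∂_tψ + (1−μ)∂_rψ) ) − l(l+1)ψ + 8M ψ/r = 0 at every point of U. Then the energy identity ∂_t E(t,r) = ∂_r F(t,r) holds at every point of U, where E(t,r) = ½r²(1+μ)(∂_tψ)² + ½r²(1−μ)(∂_rψ)² + ½(l(l+1) − 8M/r)ψ² and F(t,r) = r²∂_tψ(μ∂_tψ + (1−μ)∂_rψ). -/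
noncomputable section

open Set

/-- The mode-`l` Regge–Wheeler equation in Schwarzschild-star coordinates on
`U = ℝ × (2M,∞)`:
`∂_t( r²(−(1+μ)∂_tψ + μ∂_rψ) ) + ∂_r( r²(μ∂_tψ + (1−μ)∂_rψ) ) − l(l+1)ψ + 8Mψ/r = 0`. -/
def ReggeWheelerEq (M : ℝ) (l : ℤ) (ψ : ℝ × ℝ → ℝ) : Prop :=
  ∀ p : ℝ × ℝ, 2 * M < p.2 →
    pt (fun q : ℝ × ℝ =>
        q.2 ^ 2 * (-(1 + mu M q.2) * pt ψ q + mu M q.2 * pr ψ q)) p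
    + pr (fun q : ℝ × ℝ =>
        q.2 ^ 2 * (mu M q.2 * pt ψ q + (1 - mu M q.2) * pr ψ q)) p
    - (l : ℝ) * ((l : ℝ) + 1) * ψ p + 8 * M * ψ p / p.2 = 0

/-- The Regge–Wheeler energy density
`E = ½r²(1+μ)(∂_tψ)² + ½r²(1−μ)(∂_rψ)² + ½(l(l+1) − 8M/r)ψ²`. -/
def Erw (M : ℝ) (l : ℤ) (ψ : ℝ × ℝ → ℝ) (p : ℝ × ℝ) : ℝ :=
  (1 / 2) * p.2 ^ 2 * (1 + mu M p.2) * (pt ψ p) ^ 2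
  + (1 / 2) * p.2 ^ 2 * (1 - mu M p.2) * (pr ψ p) ^ 2
  + (1 / 2) * ((l : ℝ) * ((l : ℝ) + 1) - 8 * M / p.2) * ψ p ^ 2

/-- The energy flux `F = r²∂_tψ(μ∂_tψ + (1−μ)∂_rψ)`. -/
def Frw (M : ℝ) (ψ : ℝ × ℝ → ℝ) (p : ℝ × ℝ) : ℝ :=
  p.2 ^ 2 * pt ψ p * (mu M p.2 * pt ψ p + (1 - mu M p.2) * pr ψ p)

/-- The partial derivative `∂_t` of a differentiable function is its derivative along the line
of constant `r`. -/
theorem hasDerivAt_pt {f : ℝ × ℝ → ℝ} {p : ℝ × ℝ} (hf : DifferentiableAt ℝ f p) :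
    HasDerivAt (fun s => f (s, p.2)) (pt f p) p.1 :=
  hf.hasFDerivAt.comp_hasDerivAt p.1 ((hasDerivAt_id p.1).prodMk (hasDerivAt_const p.1 p.2))

/-- The product rule for `∂_r`. -/
theorem pr_mul {f g : ℝ × ℝ → ℝ} {p : ℝ × ℝ} (hf : DifferentiableAt ℝ f p)
    (hg : DifferentiableAt ℝ g p) :
    pr (fun q => f q * g q) p = pr f p * g p + f p * pr g p := by
  simp only [pr, fderiv_fun_mul hf hg, add_apply, smul_apply, smul_eq_mul]
  ring

theorem differentiableAt_pt {f : ℝ × ℝ → ℝ} {p : ℝ × ℝ} (hf : ContDiffAt ℝ 2 f p) :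
    DifferentiableAt ℝ (pt f) p :=
  ((hf.fderiv_right (m := 1) (by norm_num)).differentiableAt one_ne_zero).clm_apply
    (differentiableAt_const _)

theorem differentiableAt_pr {f : ℝ × ℝ → ℝ} {p : ℝ × ℝ} (hf : ContDiffAt ℝ 2 f p) :
    DifferentiableAt ℝ (pr f) p :=
  ((hf.fderiv_right (m := 1) (by norm_num)).differentiableAt one_ne_zero).clm_apply
    (differentiableAt_const _)

/-- Mixed partial derivatives of a `C²` function commute. -/
theorem pt_pr_comm {f : ℝ × ℝ → ℝ} {p : ℝ × ℝ} (hf : ContDiffAt ℝ 2 f p) :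
    pt (pr f) p = pr (pt f) p := by
  have hd : DifferentiableAt ℝ (fderiv ℝ f) p :=
    (hf.fderiv_right (m := 1) (by norm_num)).differentiableAt one_ne_zero
  have happ (v w : ℝ × ℝ) :
      fderiv ℝ (fun q => fderiv ℝ f q v) p w = fderiv ℝ (fderiv ℝ f) p w v := by
    rw [fderiv_clm_apply hd (differentiableAt_const v)]
    simp
  exact (happ _ _).trans (((hf.isSymmSndFDerivAt (by simp)).eq _ _).trans (happ _ _).symm)

/-- If `ψ` is twice continuously differentiable on
`U = ℝ × (2M,∞)` and satisfies the mode-`l` Regge–Wheeler equation at every point of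
`U`, then the energy identity `∂_t E = ∂_r F` holds at every point of `U`. -/
theorem regge_wheeler_energy_identity
    (M : ℝ) (hM : 0 < M) (l : ℤ) (hl : 2 ≤ l)
    (ψ : ℝ × ℝ → ℝ)
    (hψ : ContDiffOn ℝ 2 ψ {p : ℝ × ℝ | 2 * M < p.2})
    (hRW : ReggeWheelerEq M l ψ) :
    ∀ p : ℝ × ℝ, 2 * M < p.2 →
      pt (Erw M l ψ) p = pr (Frw M ψ) p := by
  intro p hp
  have hr : p.2 ≠ 0 := by linarith
  have hC : ContDiffAt ℝ 2 ψ p :=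
    hψ.contDiffAt ((isOpen_lt continuous_const continuous_snd).mem_nhds hp)
  have hD : DifferentiableAt ℝ ψ p := hC.differentiableAt two_ne_zero
  have hA := differentiableAt_pt hC
  have hB := differentiableAt_pr hC
  have hmu : DifferentiableAt ℝ (fun q : ℝ × ℝ => mu M q.2) p := by
    unfold mu
    fun_prop (disch := exact hr)
  have hX : DifferentiableAt ℝ (fun q : ℝ × ℝ =>
      q.2 ^ 2 * (mu M q.2 * pt ψ q + (1 - mu M q.2) * pr ψ q)) p := by
    fun_prop
  have hY : DifferentiableAt ℝ (fun q : ℝ × ℝ =>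
      q.2 ^ 2 * (-(1 + mu M q.2) * pt ψ q + mu M q.2 * pr ψ q)) p := by
    fun_prop
  have hE : DifferentiableAt ℝ (Erw M l ψ) p := by
    unfold Erw
    fun_prop (disch := exact hr)
  have hF : Frw M ψ = fun q => pt ψ q *
      (q.2 ^ 2 * (mu M q.2 * pt ψ q + (1 - mu M q.2) * pr ψ q)) := by
    funext q
    unfold Frw
    ring
  have dD := hasDerivAt_pt hD
  have dA := hasDerivAt_pt hA
  have dB := hasDerivAt_pt hB
  have eY := (hasDerivAt_pt hY).unique
    (((dA.const_mul (-(1 + mu M p.2))).add (dB.const_mul (mu M p.2))).const_mul (p.2 ^ 2))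
  have eE := (hasDerivAt_pt hE).unique
    ((((dA.pow 2).const_mul ((1 / 2) * p.2 ^ 2 * (1 + mu M p.2))).add
      ((dB.pow 2).const_mul ((1 / 2) * p.2 ^ 2 * (1 - mu M p.2)))).add
      ((dD.pow 2).const_mul ((1 / 2) * ((l : ℝ) * ((l : ℝ) + 1) - 8 * M / p.2))))
  have hEq := hRW p hp
  rw [eY] at hEq
  rw [hF, pr_mul hA hX, eE, ← pt_pr_comm hC]
  simp only [Prod.mk.eta, Nat.cast_ofNat, Nat.add_one_sub_one, pow_one]
  linear_combination (-pt ψ p) * hEq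
end
end

section
/- Let ψ : ℝ × ℝ → ℝ be twice continuously differentiable on U := ℝ × (2M,∞) and satisfy the mode-l Zerilli equation on U, and let w : (2M,∞) → ℝ be twice continuously differentiable. Then at every point of U the Lagrangian multiplier identity ∂_t[ r²w ψ(−(1+μ)∂_tψ + μ∂_rψ) − ½μr²w′ψ² ] + ∂_r[ r²w ψ(μ∂_tψ + (1−μ)∂_rψ) − ½(1−μ)r²w′ψ² ] = −r²w(1+μ)(∂_tψ)² + 2r²wμ ∂_tψ∂_rψ + r²w(1−μ)(∂_rψ)² + (l(l+1)+r²W_λ)w ψ² − ½((1−μ)r²w′)′ψ² holds, where ′ denotes d/dr. -/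
noncomputable section

open Set

/-- Directional derivative of a Lagrangian flux `u(r) ψ A − ½ g(r) ψ²`. -/
lemma fderiv_lagrangian_flux {u g : ℝ → ℝ} {ψ A : ℝ × ℝ → ℝ} {p : ℝ × ℝ}
    (hu : DifferentiableAt ℝ u p.2) (hg : DifferentiableAt ℝ g p.2)
    (hψ : DifferentiableAt ℝ ψ p) (hA : DifferentiableAt ℝ A p) (v : ℝ × ℝ) :
    fderiv ℝ (fun q : ℝ × ℝ => u q.2 * ψ q * A q - 1 / 2 * g q.2 * ψ q ^ 2) p v
      = u p.2 * ψ p * fderiv ℝ A p v + u p.2 * A p * fderiv ℝ ψ p v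
        + deriv u p.2 * v.2 * ψ p * A p
        - 1 / 2 * deriv g p.2 * v.2 * ψ p ^ 2 - g p.2 * ψ p * fderiv ℝ ψ p v := by
  have hu' := hu.hasDerivAt.comp_hasFDerivAt p (hasFDerivAt_snd (𝕜 := ℝ) (p := p))
  have hg' := hg.hasDerivAt.comp_hasFDerivAt p (hasFDerivAt_snd (𝕜 := ℝ) (p := p))
  have h := ((hu'.mul hψ.hasFDerivAt).mul hA.hasFDerivAt).sub
    ((hg'.const_mul (1 / 2)).mul (hψ.hasFDerivAt.pow 2))
  refine (congrArg (fun L : ℝ × ℝ →L[ℝ] ℝ => L v) (HasFDerivAt.fderiv h)).trans ?_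
  simp
  ring

/-- The derivative of a `C²` function on an open set, applied to a fixed vector, is
differentiable. -/
lemma ContDiffOn.differentiableAt_fderiv_apply {E : Type*} [NormedAddCommGroup E]
    [NormedSpace ℝ E] {f : E → ℝ} {s : Set E} (hf : ContDiffOn ℝ 2 f s)
    (hs : IsOpen s) {p : E} (hp : p ∈ s) (v : E) :
    DifferentiableAt ℝ (fun q => fderiv ℝ f q v) p :=
  (((hf.fderiv_of_isOpen hs (m := 1) (by norm_num)).differentiableOn
    one_ne_zero).differentiableAt (hs.mem_nhds hp)).clm_apply (differentiableAt_const v)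

lemma differentiableAt_mu (M : ℝ) {r : ℝ} (hr : r ≠ 0) : DifferentiableAt ℝ (mu M) r :=
  (differentiableAt_const (2 * M)).div differentiableAt_id hr

/-- For `ψ` twice continuously differentiable on `U = ℝ × (2M,∞)`
solving the mode-`l` Zerilli equation and `w` twice continuously differentiable on
`(2M,∞)`, the Lagrangian multiplier identity

`∂_t[ r²w ψ(−(1+μ)∂_tψ + μ∂_rψ) − ½μr²w′ψ² ]
 + ∂_r[ r²w ψ(μ∂_tψ + (1−μ)∂_rψ) − ½(1−μ)r²w′ψ² ]
 = −r²w(1+μ)(∂_tψ)² + 2r²wμ ∂_tψ∂_rψ + r²w(1−μ)(∂_rψ)²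
   + (l(l+1)+r²W_λ)w ψ² − ½((1−μ)r²w′)′ψ²`

holds at every point of `U`. -/
theorem zerilli_lagrangian_multiplier_identity
    (M : ℝ) (hM : 0 < M) (l : ℤ) (hl : 2 ≤ l)
    (lam : ℝ) (hlam : lam = ((l : ℝ) - 1) * ((l : ℝ) + 2))
    (ψ : ℝ × ℝ → ℝ)
    (hψ : ContDiffOn ℝ 2 ψ {p : ℝ × ℝ | 2 * M < p.2})
    (hZ : ZerilliEq M lam l ψ)
    (w : ℝ → ℝ) (hw : ContDiffOn ℝ 2 w (Ioi (2 * M))) :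
    ∀ p : ℝ × ℝ, 2 * M < p.2 →
      pt (fun q : ℝ × ℝ =>
          q.2 ^ 2 * w q.2 * ψ q *
              (-(1 + mu M q.2) * pt ψ q + mu M q.2 * pr ψ q)
            - (1 / 2) * mu M q.2 * q.2 ^ 2 * deriv w q.2 * ψ q ^ 2) p
      + pr (fun q : ℝ × ℝ =>
          q.2 ^ 2 * w q.2 * ψ q *
              (mu M q.2 * pt ψ q + (1 - mu M q.2) * pr ψ q)
            - (1 / 2) * (1 - mu M q.2) * q.2 ^ 2 * deriv w q.2 * ψ q ^ 2) p
      = -(p.2 ^ 2) * w p.2 * (1 + mu M p.2) * (pt ψ p) ^ 2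
        + 2 * p.2 ^ 2 * w p.2 * mu M p.2 * pt ψ p * pr ψ p
        + p.2 ^ 2 * w p.2 * (1 - mu M p.2) * (pr ψ p) ^ 2
        + ((l : ℝ) * ((l : ℝ) + 1) + p.2 ^ 2 * Wz M lam p.2) * w p.2 * ψ p ^ 2
        - (1 / 2) *
            deriv (fun r : ℝ => (1 - mu M r) * r ^ 2 * deriv w r) p.2 *
            ψ p ^ 2 := by
  intro p hp
  have hr : p.2 ≠ 0 := by linarith
  have hU : IsOpen {p : ℝ × ℝ | 2 * M < p.2} := isOpen_lt continuous_const continuous_snd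
  have hψp : DifferentiableAt ℝ ψ p :=
    (hψ.differentiableOn two_ne_zero).differentiableAt (hU.mem_nhds hp)
  have hψt : DifferentiableAt ℝ (pt ψ) p := hψ.differentiableAt_fderiv_apply hU hp (1, 0)
  have hψr : DifferentiableAt ℝ (pr ψ) p := hψ.differentiableAt_fderiv_apply hU hp (0, 1)
  have hwp : DifferentiableAt ℝ w p.2 :=
    (hw.differentiableOn two_ne_zero).differentiableAt (isOpen_Ioi.mem_nhds hp)
  have hw' : DifferentiableAt ℝ (deriv w) p.2 :=
    hw.differentiableAt_fderiv_apply isOpen_Ioi hp 1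
  have hμ := differentiableAt_mu M hr
  have hμ' : DifferentiableAt ℝ (fun q : ℝ × ℝ => mu M q.2) p :=
    hμ.comp p differentiableAt_snd
  have hA : DifferentiableAt ℝ (fun q : ℝ × ℝ =>
      q.2 ^ 2 * (-(1 + mu M q.2) * pt ψ q + mu M q.2 * pr ψ q)) p := by fun_prop
  have hB : DifferentiableAt ℝ (fun q : ℝ × ℝ =>
      q.2 ^ 2 * (mu M q.2 * pt ψ q + (1 - mu M q.2) * pr ψ q)) p := by fun_prop
  have hgt : DifferentiableAt ℝ (fun r => mu M r * r ^ 2 * deriv w r) p.2 := by fun_prop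
  have hgr : DifferentiableAt ℝ (fun r => (1 - mu M r) * r ^ 2 * deriv w r) p.2 := by
    fun_prop
  have ht := fderiv_lagrangian_flux hwp hgt hψp hA (1, 0)
  have hr' := fderiv_lagrangian_flux hwp hgr hψp hB (0, 1)
  have hZp := hZ p hp
  have et : (fun q : ℝ × ℝ => q.2 ^ 2 * w q.2 * ψ q *
        (-(1 + mu M q.2) * pt ψ q + mu M q.2 * pr ψ q)
        - (1 / 2) * mu M q.2 * q.2 ^ 2 * deriv w q.2 * ψ q ^ 2)
      = fun q => w q.2 * ψ q * (q.2 ^ 2 * (-(1 + mu M q.2) * pt ψ q + mu M q.2 * pr ψ q))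
        - 1 / 2 * (mu M q.2 * q.2 ^ 2 * deriv w q.2) * ψ q ^ 2 := by
    funext q; ring
  have er : (fun q : ℝ × ℝ => q.2 ^ 2 * w q.2 * ψ q *
        (mu M q.2 * pt ψ q + (1 - mu M q.2) * pr ψ q)
        - (1 / 2) * (1 - mu M q.2) * q.2 ^ 2 * deriv w q.2 * ψ q ^ 2)
      = fun q => w q.2 * ψ q * (q.2 ^ 2 * (mu M q.2 * pt ψ q + (1 - mu M q.2) * pr ψ q))
        - 1 / 2 * ((1 - mu M q.2) * q.2 ^ 2 * deriv w q.2) * ψ q ^ 2 := by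
    funext q; ring
  rw [et, er]
  simp only [← pt.eq_1, ← pr.eq_1] at ht hr'
  rw [ht, hr']
  linear_combination (w p.2 * ψ p) * hZp
end
end
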